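/- arXiv:2101.03588 — 4 statements merged into one kernel-verified Lean document; each statement's English description precedes it below -/
import Mathlib

section
/- Let d ≥ 2 and let X be a 2-dimensional linear subspace of ℝ^d. Let R ∈ SO(d) be a rotation matrix that maps X into X, fixes every vector of the orthogonal complement X^⊥, and satisfies ⟨Rx, x⟩ ≥ 0 for every x ∈ X (i.e., R rotates the plane X by an angle of absolute value at most π/2). Then for every p ∈ X with p ≠ 0 and every q ∈ ℝ^d with q ≠ 0, it holds that ‖Rq − q‖/‖q‖ ≤ ‖Rp − p‖/‖p‖, where ‖·‖ is the Euclidean norm. -/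
open scoped RealInnerProductSpace BigOperators Classical

noncomputable section

/-- `R` is a rotation matrix: orthogonal with determinant 1 (i.e. `R ∈ SO(d)`). -/
def IsRot {d : ℕ} (R : Matrix (Fin d) (Fin d) ℝ) : Prop :=
  R.transpose * R = 1 ∧ R.det = 1

/-- Application of a `d × d` matrix to a point of `ℝ^d` (Euclidean space). -/
def apM {d : ℕ} (R : Matrix (Fin d) (Fin d) ℝ) (p : EuclideanSpace ℝ (Fin d)) :
    EuclideanSpace ℝ (Fin d) :=
  (WithLp.equiv 2 _).symm (R.mulVec ((WithLp.equiv 2 _) p))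

/-- The ℓ_z norm of a vector of `ℝ^d`. -/
def lzNorm {d : ℕ} (z : ℝ) (u : EuclideanSpace ℝ (Fin d)) : ℝ :=
  (∑ i, |u i| ^ z) ^ (1 / z)

/-- `h : [0,∞) → [0,∞)` is `r`-log-Lipschitz: nonnegative, nondecreasing, and
`h (c⬝x) ≤ c^r ⬝ h x` for `x ≥ 0`, `c ≥ 1`. -/
def IsLogLipschitz1 (r : ℝ) (h : ℝ → ℝ) : Prop :=
  (∀ x, 0 ≤ x → 0 ≤ h x) ∧ (∀ x y, 0 ≤ x → x ≤ y → h x ≤ h y) ∧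
  (∀ x c, 0 ≤ x → 1 ≤ c → h (c * x) ≤ c ^ r * h x)

/-- `f : [0,∞)^n → [0,∞)` is `s`-log-Lipschitz: nonnegative, nondecreasing for the
coordinatewise order, and `f (c • v) ≤ c^s ⬝ f v` for nonneg `v`, `c ≥ 1`. -/
def IsLogLipschitzN {n : ℕ} (s : ℝ) (f : (Fin n → ℝ) → ℝ) : Prop :=
  (∀ v, (∀ i, 0 ≤ v i) → 0 ≤ f v) ∧
  (∀ v w, (∀ i, 0 ≤ v i) → (∀ i, v i ≤ w i) → f v ≤ f w) ∧
  (∀ v c, (∀ i, 0 ≤ v i) → 1 ≤ c → f (c • v) ≤ c ^ s * f v)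

/-- `R ∈ R_X`: a rotation matrix mapping the subspace `X` into itself and fixing
every vector of its orthogonal complement. -/
def InRotOf {d : ℕ} (X : Submodule ℝ (EuclideanSpace ℝ (Fin d)))
    (R : Matrix (Fin d) (Fin d) ℝ) : Prop :=
  IsRot R ∧ (∀ x ∈ X, apM R x ∈ X) ∧ (∀ y ∈ Xᗮ, apM R y = y)

theorem plane_aux {E : Type*} [NormedAddCommGroup E] [InnerProductSpace ℝ E]
    (X : Submodule ℝ E) (hX : Module.finrank ℝ X = 2) (T : E →ₗ[ℝ] E)
    (hT : ∀ x y, ⟪T x, T y⟫ = ⟪x, y⟫)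
    (hmap : ∀ x ∈ X, T x ∈ X) (hangle : ∀ x ∈ X, 0 ≤ ⟪T x, x⟫) :
    ∃ k : ℝ, 0 ≤ k ∧ ∀ x ∈ X, ‖T x - x‖ = k * ‖x‖ := by
  haveI : FiniteDimensional ℝ X := FiniteDimensional.of_finrank_pos (by omega)
  let B := (stdOrthonormalBasis ℝ X).reindex (finCongr hX)
  obtain ⟨e, he⟩ : ∃ e : E, e = B 0 := ⟨_, rfl⟩
  obtain ⟨f, hf⟩ : ∃ f : E, f = B 1 := ⟨_, rfl⟩
  have heX : e ∈ X := he ▸ (B 0).2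
  have hfX : f ∈ X := hf ▸ (B 1).2
  have hspan : ∀ x ∈ X, ∃ a b : ℝ, x = a • e + b • f := by
    intro x hx
    refine ⟨B.repr ⟨x, hx⟩ 0, B.repr ⟨x, hx⟩ 1, ?_⟩
    have h := congrArg (Subtype.val) (B.sum_repr ⟨x, hx⟩)
    rw [Fin.sum_univ_two] at h
    rw [he, hf]
    exact h.symm
  have h00 : ⟪e, e⟫ = (1:ℝ) := by
    rw [he, ← Submodule.coe_inner, B.inner_eq_ite]; simp
  have h11 : ⟪f, f⟫ = (1:ℝ) := by
    rw [hf, ← Submodule.coe_inner, B.inner_eq_ite]; simp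
  have h01 : ⟪e, f⟫ = (0:ℝ) := by
    rw [he, hf, ← Submodule.coe_inner, B.inner_eq_ite]; simp
  have h10 : ⟪f, e⟫ = (0:ℝ) := by rw [real_inner_comm]; exact h01
  obtain ⟨a, b, hTe⟩ := hspan _ (hmap e heX)
  obtain ⟨c, d, hTf⟩ := hspan _ (hmap f hfX)
  have key : ∀ s t u v : ℝ, ⟪s • e + t • f, u • e + v • f⟫ = s * u + t * v := by
    intro s t u v
    simp only [inner_add_left, inner_add_right, real_inner_smul_left, real_inner_smul_right,
      h00, h01, h10, h11]
    ring
  have hTx : ∀ s t : ℝ, T (s • e + t • f) = (s * a + t * c) • e + (s * b + t * d) • f := by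
    intro s t
    rw [map_add, map_smul, map_smul, hTe, hTf]
    module
  have e1 : a * a + b * b = 1 := by
    have := hT e e
    rwa [hTe, key, h00] at this
  have e2 : c * c + d * d = 1 := by
    have := hT f f
    rwa [hTf, key, h11] at this
  have e3 : a * c + b * d = 0 := by
    have := hT e f
    rwa [hTe, hTf, key, h01] at this
  have hq : ∀ s t : ℝ, 0 ≤ (s * a + t * c) * s + (s * b + t * d) * t := by
    intro s t
    have := hangle (s • e + t • f) (X.add_mem (X.smul_mem _ heX) (X.smul_mem _ hfX))
    rwa [hTx, key] at this
  have hD : (a * d - b * c) * (a * d - b * c) = 1 := by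
    linear_combination (c * c + d * d) * e1 + e2 - (a * c + b * d) * e3
  have hcd : c = -b ∧ d = a := by
    rcases mul_self_eq_one_iff.mp hD with h | h
    · constructor
      · linear_combination (-c) * e1 + a * e3 - b * h
      · linear_combination (-d) * e1 + b * e3 + a * h
    · exfalso
      have hc : c = b := by linear_combination (-c) * e1 + a * e3 - b * h
      have hd : d = -a := by linear_combination (-d) * e1 + b * e3 + a * h
      have g1 := hq 1 0
      have g2 := hq 0 1
      have g3 := hq 1 (-b)
      subst hc hd
      have ha : a = 0 := by linarith
      subst ha
      nlinarith
  obtain ⟨rfl, rfl⟩ := hcd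
  refine ⟨√(2 - 2 * d), Real.sqrt_nonneg _, ?_⟩
  intro x hx
  obtain ⟨s, t, rfl⟩ := hspan x hx
  have hd1 : d ≤ 1 := by nlinarith
  have hsub : T (s • e + t • f) - (s • e + t • f)
      = (s * d + t * -b - s) • e + (s * b + t * d - t) • f := by
    rw [hTx]; module
  rw [← sq_eq_sq₀ (norm_nonneg _) (mul_nonneg (Real.sqrt_nonneg _) (norm_nonneg _)), mul_pow,
    Real.sq_sqrt (by linarith), hsub, ← real_inner_self_eq_norm_sq, ← real_inner_self_eq_norm_sq,
    key, key]
  linear_combination (s * s + t * t) * e1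

/-- a rotation of a plane `X` by an angle of absolute value at most `π/2`
(fixing `Xᗮ`) displaces unit vectors of `X` at least as much as any other unit vector. -/
theorem stmt0 {d : ℕ} (hd : 2 ≤ d) (X : Submodule ℝ (EuclideanSpace ℝ (Fin d)))
    (hX : Module.finrank ℝ X = 2)
    (R : Matrix (Fin d) (Fin d) ℝ) (hR : IsRot R)
    (hmap : ∀ x ∈ X, apM R x ∈ X)
    (hfix : ∀ y ∈ Xᗮ, apM R y = y)
    (hangle : ∀ x ∈ X, 0 ≤ ⟪apM R x, x⟫)
    (p : EuclideanSpace ℝ (Fin d)) (hp : p ∈ X) (hp0 : p ≠ 0)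
    (q : EuclideanSpace ℝ (Fin d)) (hq0 : q ≠ 0) :
    ‖apM R q - q‖ / ‖q‖ ≤ ‖apM R p - p‖ / ‖p‖ := by
  have hap : ∀ x, apM R x = Matrix.toEuclideanLin R x := fun x => rfl
  have hT : ∀ x y, ⟪Matrix.toEuclideanLin R x, Matrix.toEuclideanLin R y⟫ = ⟪x, y⟫ := by
    intro x y
    rw [← LinearMap.adjoint_inner_right, ← Matrix.toEuclideanLin_conjTranspose_eq_adjoint]
    congr 1
    rw [← hap, ← LinearMap.id_apply (R := ℝ) y]
    simp only [apM, Matrix.toLpLin_apply, Matrix.conjTranspose_eq_transpose_of_trivial,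
      LinearMap.id_apply, WithLp.equiv_apply, WithLp.equiv_symm_apply, Matrix.mulVec_mulVec, hR.1,
      Matrix.one_mulVec]
  obtain ⟨k, hk, h⟩ := plane_aux X hX (Matrix.toEuclideanLin R) hT hmap hangle
  have hpp : 0 < ‖p‖ := norm_pos_iff.mpr hp0
  have hqp : 0 < ‖q‖ := norm_pos_iff.mpr hq0
  rw [hap, hap, h p hp, mul_div_assoc, div_self hpp.ne', mul_one, div_le_iff₀ hqp]
  obtain ⟨u, hu, v, hv, rfl⟩ := X.exists_add_mem_mem_orthogonal q
  have hfv := hfix v hv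
  rw [hap] at hfv
  have hle : ‖u‖ ≤ ‖u + v‖ := by
    have h0 : ⟪u, v⟫ = (0:ℝ) := hv u hu
    have := norm_add_sq_eq_norm_sq_add_norm_sq_of_inner_eq_zero u v h0
    nlinarith [norm_nonneg u, norm_nonneg v, norm_nonneg (u + v)]
  rw [map_add, hfv, add_sub_add_right_eq_sub, h u hu]
  exact mul_le_mul_of_nonneg_left hle hk
end
end

section
/- For every pair of nonzero vectors p, q ∈ ℝ^d there exists a vector v lying in the linear span of q with ‖v‖ = ‖p‖ such that ‖v − p‖ ≤ √2 · ‖p − q‖, and consequently ‖v − q‖ ≤ (1 + √2) · ‖p − q‖, where ‖·‖ is the Euclidean norm. -/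
open scoped RealInnerProductSpace BigOperators Classical

noncomputable section

/-- for nonzero `p, q` there is `v ∈ span{q}` with `‖v‖ = ‖p‖`,
`‖v - p‖ ≤ √2 ‖p - q‖` and hence `‖v - q‖ ≤ (1 + √2) ‖p - q‖`. -/
theorem stmt1 {d : ℕ} (p q : EuclideanSpace ℝ (Fin d)) (hp : p ≠ 0) (hq : q ≠ 0) :
    ∃ v ∈ Submodule.span ℝ {q}, ‖v‖ = ‖p‖ ∧
      ‖v - p‖ ≤ Real.sqrt 2 * ‖p - q‖ ∧
      ‖v - q‖ ≤ (1 + Real.sqrt 2) * ‖p - q‖ := by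
  have ha : 0 < ‖p‖ := norm_pos_iff.mpr hp
  have hb : 0 < ‖q‖ := norm_pos_iff.mpr hq
  obtain ⟨t, ht⟩ : ∃ t : ℝ, inner ℝ p q = t * ‖q‖ :=
    ⟨inner ℝ p q / ‖q‖, by field_simp⟩
  have hcs : |t| ≤ ‖p‖ := by
    have h := abs_real_inner_le_norm p q
    rw [ht, abs_mul, abs_of_pos hb] at h
    exact le_of_mul_le_mul_right h hb
  obtain ⟨hl, hu⟩ := abs_le.mp hcs
  have hpq : ‖p - q‖ ^ 2 = ‖p‖ ^ 2 - 2 * (t * ‖q‖) + ‖q‖ ^ 2 := by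
    rw [norm_sub_sq_real, ht]
  obtain ⟨e, he, hk⟩ : ∃ e : ℝ, |e| = 1 ∧
      2 * ‖p‖ ^ 2 - 2 * (e * ‖p‖ * t) ≤ 2 * ‖p - q‖ ^ 2 := by
    rw [hpq]
    rcases le_total 0 t with h | h
    · refine ⟨1, by simp, ?_⟩
      nlinarith [sq_nonneg (‖q‖ - t), mul_nonneg h (sub_nonneg.mpr hu)]
    · refine ⟨-1, by simp, ?_⟩
      nlinarith [mul_nonneg (neg_nonneg.mpr h) hb.le, mul_nonneg (neg_nonneg.mpr h) ha.le,
        sq_nonneg ‖q‖]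
  have hv : ‖(e * ‖p‖ / ‖q‖) • q‖ = ‖p‖ := by
    rw [norm_smul, Real.norm_eq_abs, abs_div, abs_mul, he, abs_of_pos ha, abs_of_pos hb]
    field_simp
  have h1 : ‖(e * ‖p‖ / ‖q‖) • q - p‖ ≤ Real.sqrt 2 * ‖p - q‖ := by
    refine (sq_le_sq₀ (norm_nonneg _) (by positivity)).mp ?_
    rw [mul_pow, Real.sq_sqrt (by norm_num), norm_sub_sq_real, hv, real_inner_smul_left,
      real_inner_comm, ht]
    have : e * ‖p‖ / ‖q‖ * (t * ‖q‖) = e * ‖p‖ * t := by field_simp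
    rw [this]
    linarith
  refine ⟨_, Submodule.smul_mem _ _ (Submodule.mem_span_singleton_self q), hv, h1, ?_⟩
  have := norm_sub_le_norm_sub_add_norm_sub ((e * ‖p‖ / ‖q‖) • q) p q
  linarith
end
end

section
/- Let u, v ∈ ℝ^d with v ≠ 0, ‖u‖ = ‖v‖, and ⟨u, v⟩ ≥ 0 (i.e., the angle between u and v is at most π/2). Then ‖u − v‖ ≤ √2 · dist(u, span(v)), where dist(u, span(v)) denotes the infimum of ‖u − x‖ over all x in the linear span of v, and ‖·‖ is the Euclidean norm. -/
open scoped RealInnerProductSpace BigOperators Classical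

noncomputable section

/-- if `‖u‖ = ‖v‖`, `v ≠ 0` and `⟪u, v⟫ ≥ 0` then
`‖u - v‖ ≤ √2 · dist(u, span v)`. -/
theorem stmt3 {d : ℕ} (u v : EuclideanSpace ℝ (Fin d)) (hv : v ≠ 0)
    (hnorm : ‖u‖ = ‖v‖) (hangle : 0 ≤ ⟪u, v⟫) :
    ‖u - v‖ ≤ Real.sqrt 2 *
      Metric.infDist u ((Submodule.span ℝ {v} : Submodule ℝ (EuclideanSpace ℝ (Fin d))) : Set (EuclideanSpace ℝ (Fin d))) := by
  have hne : ((Submodule.span ℝ {v} : Submodule ℝ (EuclideanSpace ℝ (Fin d))) :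
      Set (EuclideanSpace ℝ (Fin d))).Nonempty := ⟨0, Submodule.zero_mem _⟩
  have h2 : (0 : ℝ) < Real.sqrt 2 := by positivity
  rw [← div_le_iff₀' h2]
  refine (Metric.le_infDist hne).2 ?_
  intro x hx
  obtain ⟨a, rfl⟩ := Submodule.mem_span_singleton.1 hx
  rw [div_le_iff₀' h2, dist_eq_norm]
  refine (sq_le_sq₀ (by positivity) (by positivity)).1 ?_
  have hs : Real.sqrt 2 ^ 2 = 2 := Real.sq_sqrt (by norm_num)
  have hp : ⟪u, v⟫ ≤ ‖v‖ ^ 2 := by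
    have := real_inner_le_norm u v
    rw [hnorm] at this
    nlinarith
  rw [mul_pow, hs, norm_sub_sq_real, norm_sub_sq_real, inner_smul_right, norm_smul, mul_pow,
    hnorm, Real.norm_eq_abs, sq_abs]
  nlinarith [mul_nonneg (sq_nonneg a) (sub_nonneg.2 hp), mul_nonneg hangle (sq_nonneg (a - 1))]
end
end

section
/- Let p_1,…,p_n and q_1,…,q_n be points in ℝ^d, let z ≥ 1, let ℓ : [0,∞) → [0,∞) be r-log-Lipschitz, and set ρ = max{2^{r−1}, 1} and c = d^{|1/z − 1/2|}. Let u ∈ ℝ^d be a unit vector, let H = u^⊥ be the hyperplane through the origin orthogonal to u, and let P_H denote the orthogonal projection onto H. Let R ∈ SO(d) be a rotation matrix with Ru = u (a rotation about the axis u). If Σ_{i=1}^n ℓ(‖P_H(Rp_i) − P_H(q_i)‖_z) ≤ 6·ρ^2·c^{2r} · Σ_{i=1}^n ℓ(‖P_H(p_i) − P_H(q_i)‖_z), then Σ_{i=1}^n ℓ(‖Rp_i − q_i‖_z) ≤ 12·ρ^4·c^{5r} · Σ_{i=1}^n ℓ(‖p_i − q_i‖_z). -/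
open scoped RealInnerProductSpace BigOperators Classical

noncomputable section

theorem aux_sum_rpow {ι : Type} (s : Finset ι) (f : ι → ℝ) (hf : ∀ i, 0 ≤ f i) (k : ℝ) (hk : 1 ≤ k) :
    ∑ i ∈ s, f i ^ k ≤ (∑ i ∈ s, f i) ^ k := by
  induction s using Finset.induction_on with
  | empty => simp [Real.zero_rpow (by linarith : k ≠ 0)]
  | insert a s ha ih =>
    rw [Finset.sum_insert ha, Finset.sum_insert ha]
    exact (add_le_add_right ih _).trans
      (Real.add_rpow_le_rpow_add (hf a) (Finset.sum_nonneg fun i _ => hf i) hk)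

theorem lz_nonneg {d : ℕ} (z : ℝ) (x : EuclideanSpace ℝ (Fin d)) : 0 ≤ lzNorm z x := by
  unfold lzNorm; positivity

theorem lz_anti {d : ℕ} (s t : ℝ) (hs : 1 ≤ s) (hst : s ≤ t) (x : EuclideanSpace ℝ (Fin d)) :
    lzNorm t x ≤ lzNorm s x := by
  unfold lzNorm
  have hs0 : 0 < s := by linarith
  have ht0 : 0 < t := by linarith
  have h := aux_sum_rpow Finset.univ (fun i => |x i| ^ s) (fun i => by positivity) (t / s)
    ((one_le_div hs0).2 hst)
  have e : ∀ i, (|x i| ^ s) ^ (t / s) = |x i| ^ t := fun i => by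
    rw [← Real.rpow_mul (abs_nonneg _)]; congr 1; field_simp
  simp only [e] at h
  calc (∑ i, |x i| ^ t) ^ (1 / t) ≤ ((∑ i, |x i| ^ s) ^ (t / s)) ^ (1 / t) := by
        apply Real.rpow_le_rpow _ h (by positivity)
        positivity
    _ = _ := by
        rw [← Real.rpow_mul (by positivity)]; congr 1; field_simp

theorem lz_holder {d : ℕ} (s t : ℝ) (hs : 1 ≤ s) (hst : s ≤ t) (x : EuclideanSpace ℝ (Fin d)) :
    lzNorm s x ≤ (d : ℝ) ^ (1 / s - 1 / t) * lzNorm t x := by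
  unfold lzNorm
  have hs0 : 0 < s := by linarith
  have ht0 : 0 < t := by linarith
  have h := Real.rpow_sum_le_const_mul_sum_rpow_of_nonneg (p := t / s) Finset.univ
    (f := fun i => |x i| ^ s) ((one_le_div hs0).2 hst) (fun i _ => by positivity)
  have e : ∀ i, (|x i| ^ s) ^ (t / s) = |x i| ^ t := fun i => by
    rw [← Real.rpow_mul (abs_nonneg _)]; congr 1; field_simp
  simp only [e, Finset.card_univ, Fintype.card_fin] at h
  calc (∑ i, |x i| ^ s) ^ (1 / s) = ((∑ i, |x i| ^ s) ^ (t / s)) ^ (1 / t) := by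
        rw [← Real.rpow_mul (by positivity)]; congr 1; field_simp
    _ ≤ ((d : ℝ) ^ (t / s - 1) * ∑ i, |x i| ^ t) ^ (1 / t) := by
        apply Real.rpow_le_rpow _ h (by positivity)
        positivity
    _ = _ := by
        rw [Real.mul_rpow (by positivity) (by positivity), ← Real.rpow_mul (by positivity)]
        congr 2; field_simp

theorem lz_two {d : ℕ} (x : EuclideanSpace ℝ (Fin d)) : lzNorm 2 x = ‖x‖ := by
  rw [EuclideanSpace.norm_eq, Real.sqrt_eq_rpow]
  simp [lzNorm]

theorem lz_cmp {d : ℕ} (hd : (1 : ℝ) ≤ d) (z : ℝ) (hz : 1 ≤ z) (x : EuclideanSpace ℝ (Fin d)) :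
    lzNorm z x ≤ (d : ℝ) ^ |1 / z - 1 / 2| * ‖x‖ ∧ ‖x‖ ≤ (d : ℝ) ^ |1 / z - 1 / 2| * lzNorm z x := by
  have hc : (1 : ℝ) ≤ (d : ℝ) ^ |1 / z - 1 / 2| := Real.one_le_rpow hd (abs_nonneg _)
  rw [← lz_two]
  rcases le_total z 2 with h | h
  · have h1 := lz_anti z 2 hz h x
    have h2 := lz_holder z 2 hz h x
    have : 0 ≤ 1 / z - 1 / 2 := by
      have := one_div_le_one_div_of_le (by linarith) h
      linarith
    rw [abs_of_nonneg this] at hc ⊢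
    exact ⟨h2, h1.trans (le_mul_of_one_le_left (lz_nonneg _ _) hc)⟩
  · have h1 := lz_anti 2 z (by norm_num) h x
    have h2 := lz_holder 2 z (by norm_num) h x
    have : 1 / z - 1 / 2 ≤ 0 := by
      have := one_div_le_one_div_of_le (by norm_num) h
      linarith
    rw [abs_of_nonpos this, neg_sub] at hc ⊢
    exact ⟨h1.trans (le_mul_of_one_le_left (lz_nonneg _ _) hc), h2⟩

theorem lz_add {d : ℕ} (z : ℝ) (hz : 1 ≤ z) (x y : EuclideanSpace ℝ (Fin d)) :
    lzNorm z (x + y) ≤ lzNorm z x + lzNorm z y := by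
  simpa [lzNorm] using Real.Lp_add_le Finset.univ (fun i => x i) (fun i => y i) hz

theorem rpow_quasi (r x y : ℝ) (hr : 0 < r) (hx : 0 ≤ x) (hy : 0 ≤ y) :
    (x + y) ^ r ≤ max ((2 : ℝ) ^ (r - 1)) 1 * (x ^ r + y ^ r) := by
  have h0 : 0 ≤ x ^ r + y ^ r := by positivity
  rcases le_total r 1 with h | h
  · exact (Real.rpow_add_le_add_rpow hx hy hr.le h).trans
      (le_mul_of_one_le_left h0 (le_max_right _ _))
  · have := Real.rpow_sum_le_const_mul_sum_rpow_of_nonneg (p := r) Finset.univ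
      (f := ![x, y]) h (fun i _ => by fin_cases i <;> simpa)
    simp [Fin.sum_univ_two] at this
    exact this.trans (mul_le_mul_of_nonneg_right (le_max_left _ _) h0)

theorem ll_add (r : ℝ) (hr : 0 < r) (h : ℝ → ℝ) (hh : IsLogLipschitz1 r h) (x y : ℝ)
    (hx : 0 ≤ x) (hy : 0 ≤ y) :
    h (x + y) ≤ max ((2 : ℝ) ^ (r - 1)) 1 * (h x + h y) := by
  obtain ⟨h0, h1, h2⟩ := hh
  have hρ : (1 : ℝ) ≤ max ((2 : ℝ) ^ (r - 1)) 1 := le_max_right _ _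
  have key : ∀ a b : ℝ, 0 ≤ a → 0 ≤ b → a ^ r * h (a + b) ≤ (a + b) ^ r * h a := by
    intro a b ha hb
    rcases ha.eq_or_lt with rfl | ha'
    · rw [Real.zero_rpow hr.ne', zero_mul]
      have := h0 0 le_rfl
      positivity
    · have := h2 a ((a + b) / a) ha ((one_le_div ha').2 (by linarith))
      rw [div_mul_cancel₀ _ ha'.ne', Real.div_rpow (by linarith) ha, div_mul_eq_mul_div,
        le_div_iff₀ (by positivity)] at this
      linarith
  have hs : 0 ≤ x + y := by linarith
  rcases hs.eq_or_lt with e | hpos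
  · have hx0 : x = 0 := by linarith
    have hy0 : y = 0 := by linarith
    subst hx0 hy0
    have := h0 0 le_rfl
    rw [add_zero]
    nlinarith
  · have k1 := key x y hx hy
    have k2 := key y x hy hx
    rw [add_comm y x] at k2
    have q := rpow_quasi r x y hr hx hy
    have hL := h0 _ hs
    have hp : 0 < (x + y) ^ r := by positivity
    refine le_of_mul_le_mul_left ?_ hp
    calc (x + y) ^ r * h (x + y) ≤ max ((2 : ℝ) ^ (r - 1)) 1 * (x ^ r + y ^ r) * h (x + y) :=
          mul_le_mul_of_nonneg_right q hL
      _ = max ((2 : ℝ) ^ (r - 1)) 1 * (x ^ r * h (x + y) + y ^ r * h (x + y)) := by ring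
      _ ≤ max ((2 : ℝ) ^ (r - 1)) 1 * ((x + y) ^ r * h x + (x + y) ^ r * h y) := by gcongr
      _ = _ := by ring

theorem apM_inner {d : ℕ} (R : Matrix (Fin d) (Fin d) ℝ) (hR : IsRot R)
    (x y : EuclideanSpace ℝ (Fin d)) : ⟪apM R x, apM R y⟫ = ⟪x, y⟫ := by
  simp only [apM, EuclideanSpace.inner_eq_star_dotProduct, star_trivial]
  simp only [WithLp.equiv_apply, WithLp.equiv_symm_apply]
  rw [Matrix.dotProduct_mulVec, Matrix.vecMul_mulVec, hR.1, Matrix.vecMul_one]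

/-- if a rotation `R` about the axis `u` approximates the projected cost
(onto the hyperplane `H = u^⊥`) within factor `6ρ²c^{2r}`, then it approximates the
unprojected cost within factor `12ρ⁴c^{5r}`. -/
theorem stmt17 {d n : ℕ} (z r : ℝ) (hz : 1 ≤ z) (hr : 0 < r)
    (p q : Fin n → EuclideanSpace ℝ (Fin d))
    (ℓ : ℝ → ℝ) (hℓ : IsLogLipschitz1 r ℓ)
    (ρ c : ℝ) (hρ : ρ = max ((2 : ℝ) ^ (r - 1)) 1)
    (hc : c = (d : ℝ) ^ |1 / z - 1 / 2|)
    (u : EuclideanSpace ℝ (Fin d)) (hu : ‖u‖ = 1)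
    (PH : EuclideanSpace ℝ (Fin d) → EuclideanSpace ℝ (Fin d))
    (hPH : ∀ x, PH x = x - ⟪x, u⟫ • u)
    (R : Matrix (Fin d) (Fin d) ℝ) (hR : IsRot R) (haxis : apM R u = u)
    (hproj : ∑ i, ℓ (lzNorm z (PH (apM R (p i)) - PH (q i))) ≤
      6 * ρ ^ 2 * c ^ (2 * r) * ∑ i, ℓ (lzNorm z (PH (p i) - PH (q i)))) :
    ∑ i, ℓ (lzNorm z (apM R (p i) - q i)) ≤
      12 * ρ ^ 4 * c ^ (5 * r) * ∑ i, ℓ (lzNorm z (p i - q i)) := by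
  have hd : (1 : ℝ) ≤ d := by
    rcases Nat.eq_zero_or_pos d with h | h
    · subst h
      rw [Subsingleton.elim u 0, norm_zero] at hu
      norm_num at hu
    · exact_mod_cast h
  have hc1 : 1 ≤ c := hc ▸ Real.one_le_rpow hd (abs_nonneg _)
  have hc0 : 0 ≤ c := by linarith
  have hρ1 : 1 ≤ ρ := hρ ▸ le_max_right _ _
  have hcmp : ∀ x, lzNorm z x ≤ c * ‖x‖ ∧ ‖x‖ ≤ c * lzNorm z x := fun x =>
    hc ▸ lz_cmp hd z hz x
  have huu : ⟪u, u⟫ = (1 : ℝ) := by rw [real_inner_self_eq_norm_sq, hu]; norm_num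
  have hin : ∀ x, ⟪apM R x, u⟫ = ⟪x, u⟫ := fun x => by
    have := apM_inner R hR x u
    rwa [haxis] at this
  have hsub : ∀ x y, PH x - PH y = PH (x - y) := fun x y => by
    simp only [hPH, inner_sub_left]; module
  have hn2 : ∀ x, ‖⟪x, u⟫ • u‖ ≤ ‖x‖ := fun x => by
    rw [norm_smul, hu, mul_one]
    simpa [hu] using norm_inner_le_norm (𝕜 := ℝ) x u
  have hn1 : ∀ x, ‖PH x‖ ≤ ‖x‖ := fun x => by
    have : ‖PH x‖ ^ 2 ≤ ‖x‖ ^ 2 := by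
      rw [hPH, ← real_inner_self_eq_norm_sq, ← real_inner_self_eq_norm_sq]
      simp only [inner_sub_left, inner_sub_right, inner_smul_left, inner_smul_right, huu,
        real_inner_comm x u]
      simp
      nlinarith [mul_self_nonneg ⟪x, u⟫]
    exact (sq_le_sq₀ (norm_nonneg _) (norm_nonneg _)).1 this
  have hbd : ∀ x y : EuclideanSpace ℝ (Fin d), ‖y‖ ≤ ‖x‖ →
      ℓ (lzNorm z y) ≤ c ^ (2 * r) * ℓ (lzNorm z x) := fun x y hxy => by
    have h1 : lzNorm z y ≤ (c * c) * lzNorm z x :=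
      calc lzNorm z y ≤ c * ‖y‖ := (hcmp y).1
        _ ≤ c * ‖x‖ := by gcongr
        _ ≤ c * (c * lzNorm z x) := by gcongr; exact (hcmp x).2
        _ = _ := by ring
    have h2 := hℓ.2.1 _ _ (lz_nonneg z y) h1
    have h3 := hℓ.2.2 (lzNorm z x) (c * c) (lz_nonneg z x) (by nlinarith)
    have h4 : (c * c) ^ r = c ^ (2 * r) := by
      rw [Real.rpow_mul hc0]; norm_num [sq]
    rw [h4] at h3
    exact h2.trans h3
  set S := ∑ i, ℓ (lzNorm z (p i - q i)) with hS
  have hS0 : 0 ≤ S := Finset.sum_nonneg fun i _ => hℓ.1 _ (lz_nonneg _ _)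
  have A1 : ∑ i, ℓ (lzNorm z (PH (p i) - PH (q i))) ≤ c ^ (2 * r) * S := by
    rw [hS, Finset.mul_sum]
    exact Finset.sum_le_sum fun i _ => by rw [hsub]; exact hbd _ _ (hn1 _)
  have A2 : ∑ i, ℓ (lzNorm z (⟪p i - q i, u⟫ • u)) ≤ c ^ (2 * r) * S := by
    rw [hS, Finset.mul_sum]
    exact Finset.sum_le_sum fun i _ => hbd _ _ (hn2 _)
  have A3 : ∑ i, ℓ (lzNorm z (apM R (p i) - q i)) ≤
      ρ * (∑ i, ℓ (lzNorm z (PH (apM R (p i)) - PH (q i))) +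
        ∑ i, ℓ (lzNorm z (⟪p i - q i, u⟫ • u))) := by
    rw [← Finset.sum_add_distrib, Finset.mul_sum]
    refine Finset.sum_le_sum fun i _ => ?_
    have e : apM R (p i) - q i =
        (PH (apM R (p i)) - PH (q i)) + ⟪p i - q i, u⟫ • u := by
      simp only [hPH, inner_sub_left, hin]; module
    have h1 := lz_add z hz (PH (apM R (p i)) - PH (q i)) (⟪p i - q i, u⟫ • u)
    rw [← e] at h1
    rw [hρ]
    exact (hℓ.2.1 _ _ (lz_nonneg _ _) h1).trans
      (ll_add r hr ℓ hℓ _ _ (lz_nonneg _ _) (lz_nonneg _ _))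
  set C := c ^ (2 * r) with hC
  have hC1 : 1 ≤ C := Real.one_le_rpow hc1 (by linarith)
  have h5 : C * C ≤ c ^ (5 * r) := by
    rw [hC, ← Real.rpow_add (by linarith)]
    exact Real.rpow_le_rpow_of_exponent_le hc1 (by linarith)
  have hρ0 : 0 ≤ ρ := by linarith
  calc _ ≤ _ := A3
    _ ≤ ρ * (6 * ρ ^ 2 * C * (C * S) + C * S) := by
        gcongr
        exact hproj.trans (by gcongr)
    _ = (6 * ρ ^ 3 * (C * C) + ρ * (1 * C)) * S := by ring
    _ ≤ (6 * ρ ^ 4 * (C * C) + ρ ^ 4 * (C * C)) * S := by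
        gcongr
        · norm_num
        · exact le_self_pow₀ hρ1 (by norm_num)
    _ = 7 * ρ ^ 4 * (C * C) * S := by ring
    _ ≤ 12 * ρ ^ 4 * c ^ (5 * r) * S := by gcongr; norm_num
end
end
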